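/- Fix K ≥ 1. Let P_∞ be the infinite product over ℕ (indexed from 1) of the standard Gaussian measure N(0, I) on ℝ^K, a probability measure on the trajectory space (ℝ^K)^ℕ. Let A be a real K×K matrix, R and Σ₀ symmetric positive definite K×K matrices, and μ₀ ∈ ℝ^K. For a trajectory y = (y_1, y_2, …), define deterministically Σ_t = (AΣ_{t−1}Aᵀ + R)(AΣ_{t−1}Aᵀ + R + I)⁻¹ and measurably μ_t(y) = (AΣ_{t−1}Aᵀ + R + I)⁻¹ A μ_{t−1}(y) + Σ_t y_t for t ≥ 1 (so Σ_t is symmetric positive definite for every t). Define the likelihood ratio L_0 := 1 and L_t(y) := Π_{i=1}^{t} N(y_i; A μ_{i−1}(y), A Σ_{i−1} Aᵀ + R + I) / N(y_i; 0, I). Then for every t ≥ 0, ∫ L_t dP_∞ = 1. -/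

import Mathlib

open Matrix MeasureTheory ProbabilityTheory
open scoped ENNReal

/-- The Gaussian density `N(x; m, S)` on `ℝ^K` with mean `m` and (symmetric positive
definite) covariance matrix `S`. -/
noncomputable def gaussDensity {K : ℕ} (m : Fin K → ℝ) (S : Matrix (Fin K) (Fin K) ℝ)
    (x : Fin K → ℝ) : ℝ :=
  (Real.sqrt ((2 * Real.pi) ^ K * S.det))⁻¹ *
    Real.exp (-(1 / 2 : ℝ) * ((x - m) ⬝ᵥ (S⁻¹ *ᵥ (x - m))))

/-- The standard Gaussian measure `N(0, I)` on `ℝ^K`, the `K`-fold product of the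
standard real Gaussian measure. -/
noncomputable def stdGauss (K : ℕ) : Measure (Fin K → ℝ) :=
  Measure.pi fun _ : Fin K => gaussianReal 0 1

theorem lintegral_pi_prod_aux (n : ℕ) (ν : Fin n → Measure ℝ) [∀ i, SigmaFinite (ν i)]
    (f : ℝ → ℝ≥0∞) (hf : Measurable f) :
    ∫⁻ x, ∏ i, f (x i) ∂(Measure.pi ν) = ∏ i, ∫⁻ x, f x ∂(ν i) := by
  induction n with
  | zero => simp
  | succ n ih =>
    rw [← ((measurePreserving_piFinSuccAbove ν 0).symm).lintegral_comp_emb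
      (MeasurableEquiv.measurableEmbedding _), Fin.prod_univ_succ]
    simp only [Fin.prod_univ_succ, MeasurableEquiv.piFinSuccAbove_symm_apply]
    simp only [Fin.insertNthEquiv_apply, Fin.insertNth_zero', Fin.cons_zero, Fin.cons_succ,
      Fin.succAbove_zero]
    rw [lintegral_prod_mul (g := fun x : Fin n → ℝ => ∏ i, f (x i)) hf.aemeasurable
      (Finset.measurable_prod _ fun i _ => hf.comp (measurable_pi_apply i)).aemeasurable, ih]

theorem gaussDensity_pos {K : ℕ} (m : Fin K → ℝ) {S : Matrix (Fin K) (Fin K) ℝ} (hS : S.PosDef)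
    (x : Fin K → ℝ) : 0 < gaussDensity m S x := by
  have := hS.det_pos
  unfold gaussDensity
  positivity

theorem gaussDensity_std {K : ℕ} (x : Fin K → ℝ) :
    ENNReal.ofReal (gaussDensity 0 1 x) = ∏ i, gaussianPDF 0 1 (x i) := by
  simp only [gaussianPDF]
  rw [← ENNReal.ofReal_prod_of_nonneg (fun i _ => gaussianPDFReal_nonneg _ _ _)]
  congr 1
  simp only [gaussDensity, gaussianPDFReal, Finset.prod_mul_distrib, Finset.prod_const,
    ← Real.exp_sum]
  congr 1
  · simp only [det_one, mul_one, NNReal.coe_one, Finset.card_univ, Fintype.card_fin, inv_pow]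
    congr 1
    refine (Real.sqrt_eq_iff_mul_self_eq (by positivity) (by positivity)).2 ?_
    rw [← mul_pow, Real.mul_self_sqrt (by positivity)]
  · congr 1
    simp only [sub_zero, inv_one, one_mulVec, dotProduct, Finset.mul_sum, NNReal.coe_one]
    exact Finset.sum_congr rfl fun i _ => by ring

theorem measurable_gaussDensity {K : ℕ} (S : Matrix (Fin K) (Fin K) ℝ) :
    Measurable fun p : (Fin K → ℝ) × (Fin K → ℝ) => gaussDensity p.1 S p.2 := by
  unfold gaussDensity
  refine Continuous.measurable ?_
  fun_prop

theorem measurable_gaussDensity_comp {K : ℕ} {α : Type*} [MeasurableSpace α]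
    (S : Matrix (Fin K) (Fin K) ℝ) {f g : α → Fin K → ℝ} (hf : Measurable f) (hg : Measurable g) :
    Measurable fun a => gaussDensity (f a) S (g a) :=
  Measurable.comp (g := fun p : (Fin K → ℝ) × (Fin K → ℝ) => gaussDensity p.1 S p.2)
    (f := fun a => (f a, g a)) (measurable_gaussDensity S) (hf.prodMk hg)

theorem stdGauss_eq (K : ℕ) : stdGauss K =
    (volume : Measure (Fin K → ℝ)).withDensity fun x => ENNReal.ofReal (gaussDensity 0 1 x) := by
  refine Measure.pi_eq fun s hs => ?_
  rw [withDensity_apply _ (MeasurableSet.univ_pi hs)]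
  simp only [gaussDensity_std]
  rw [volume_pi, Measure.restrict_pi_pi, lintegral_pi_prod_aux _ _ _ (measurable_gaussianPDF 0 1)]
  refine Finset.prod_congr rfl fun i _ => ?_
  rw [gaussianReal_of_var_ne_zero _ one_ne_zero, withDensity_apply _ (hs i)]

theorem lintegral_std (K : ℕ) :
    ∫⁻ x : Fin K → ℝ, ENNReal.ofReal (gaussDensity 0 1 x) = 1 := by
  have : (stdGauss K) Set.univ = 1 := by
    unfold stdGauss; exact measure_univ
  rwa [stdGauss_eq, withDensity_apply _ MeasurableSet.univ, Measure.restrict_univ] at this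

open scoped MatrixOrder in
theorem exists_factor {K : ℕ} {S : Matrix (Fin K) (Fin K) ℝ} (hS : S.PosDef) :
    ∃ B : Matrix (Fin K) (Fin K) ℝ, S⁻¹ = Bᵀ * B := by
  obtain ⟨B, hB⟩ := CStarAlgebra.nonneg_iff_eq_star_mul_self.mp hS.inv.posSemidef.nonneg
  exact ⟨B, by rw [hB, star_eq_conjTranspose, conjTranspose_eq_transpose_of_trivial]⟩

theorem lintegral_gaussDensity {K : ℕ} (m : Fin K → ℝ) {S : Matrix (Fin K) (Fin K) ℝ}
    (hS : S.PosDef) : ∫⁻ x : Fin K → ℝ, ENNReal.ofReal (gaussDensity m S x) = 1 := by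
  obtain ⟨B, hB⟩ := exists_factor hS
  have hd : S.det⁻¹ = B.det ^ 2 := by
    have := congrArg det hB
    rw [det_mul, det_transpose, det_nonsing_inv, Ring.inverse_eq_inv'] at this
    rw [this]; ring
  have hdS := hS.det_pos
  have hB0 : B.det ≠ 0 := by
    intro h
    rw [h] at hd
    have := inv_pos.2 hdS
    simp_all
  have key : ∀ x, gaussDensity m S x = |B.det| * gaussDensity 0 1 (toLin' B (x - m)) := by
    intro x
    have h1 : (x - m) ⬝ᵥ (S⁻¹ *ᵥ (x - m)) = (B *ᵥ (x - m)) ⬝ᵥ (B *ᵥ (x - m)) := by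
      rw [hB, ← mulVec_mulVec, dotProduct_mulVec, vecMul_transpose]
    have h2 : (Real.sqrt ((2 * Real.pi) ^ K * S.det))⁻¹
        = |B.det| * (Real.sqrt ((2 * Real.pi) ^ K))⁻¹ := by
      rw [← Real.sqrt_inv, mul_inv, hd, Real.sqrt_mul (by positivity), Real.sqrt_sq_eq_abs,
        Real.sqrt_inv, mul_comm]
    simp only [gaussDensity, h1, h2, det_one, mul_one, inv_one, one_mulVec, sub_zero,
      toLin'_apply, mul_assoc]
  have hmeas : Measurable fun x : Fin K → ℝ => ENNReal.ofReal (gaussDensity 0 1 x) :=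
    (measurable_gaussDensity_comp 1 measurable_const measurable_id).ennreal_ofReal
  have hlin : Measurable (toLin' B) := (LinearMap.continuous_of_finiteDimensional _).measurable
  simp only [key, ENNReal.ofReal_mul (abs_nonneg _)]
  rw [lintegral_sub_right_eq_self (μ := volume)
    (fun x => ENNReal.ofReal |B.det| * ENNReal.ofReal (gaussDensity 0 1 (toLin' B x))) m,
    lintegral_const_mul' _ _ ENNReal.ofReal_ne_top, ← lintegral_map hmeas hlin,
    Real.map_matrix_volume_pi_eq_smul_volume_pi hB0, lintegral_smul_measure, lintegral_std,
    smul_eq_mul, mul_one, ← ENNReal.ofReal_mul (abs_nonneg _), ← abs_mul, mul_inv_cancel₀ hB0]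
  simp

theorem lintegral_ratio {K : ℕ} (m : Fin K → ℝ) {S : Matrix (Fin K) (Fin K) ℝ}
    (hS : S.PosDef) :
    ∫⁻ x, ENNReal.ofReal (gaussDensity m S x / gaussDensity 0 1 x) ∂(stdGauss K) = 1 := by
  have hmeas : ∀ (m) (S : Matrix (Fin K) (Fin K) ℝ), Measurable fun x : Fin K → ℝ => (gaussDensity m S x) :=
    fun m S => measurable_gaussDensity_comp S measurable_const measurable_id
  have h1 := (hmeas 0 1).ennreal_ofReal
  have h2 : Measurable fun x => ENNReal.ofReal (gaussDensity m S x / gaussDensity 0 1 x) :=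
    Measurable.ennreal_ofReal (Measurable.div (hmeas m S) (hmeas 0 1))
  rw [stdGauss_eq, lintegral_withDensity_eq_lintegral_mul _ h1 h2, ← lintegral_gaussDensity m hS]
  refine lintegral_congr fun x => ?_
  have := gaussDensity_pos 0 (PosDef.one (n := Fin K) (R := ℝ)) x
  rw [Pi.mul_apply, ← ENNReal.ofReal_mul this.le, mul_div_cancel₀ _ this.ne']

theorem posDef_step {K : ℕ} {A R S : Matrix (Fin K) (Fin K) ℝ} (hR : R.PosDef) (hS : S.PosDef) :
    (A * S * Aᵀ + R).PosDef := by
  have := hS.posSemidef.mul_mul_conjTranspose_same A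
  rw [conjTranspose_eq_transpose_of_trivial] at this
  exact hR.posSemidef_add this

theorem posDef_next {K : ℕ} {M : Matrix (Fin K) (Fin K) ℝ} (hM : M.PosDef) :
    (M * (M + 1)⁻¹).PosDef := by
  have h1 : (M + 1).PosDef := hM.add PosDef.one
  have hu := (isUnit_iff_isUnit_det _).1 hM.isUnit
  have hu1 := (isUnit_iff_isUnit_det _).1 h1.isUnit
  have : (1 + M⁻¹) * (M * (M + 1)⁻¹) = 1 := by
    rw [← mul_assoc, add_mul, one_mul, nonsing_inv_mul _ hu, mul_nonsing_inv _ hu1]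
  rw [← inv_eq_right_inv this]
  exact (PosDef.one.add hM.inv).inv

/-- Extend a finite trajectory, indexed from 1, by zero. -/
noncomputable def extTraj {K n : ℕ} (z : Fin n → Fin K → ℝ) : ℕ → Fin K → ℝ :=
  fun i => if h : i - 1 < n then z ⟨i - 1, h⟩ else 0

theorem measurable_extTraj (K n : ℕ) :
    Measurable (extTraj : (Fin n → Fin K → ℝ) → ℕ → Fin K → ℝ) := by
  refine measurable_pi_lambda _ fun i => ?_
  unfold extTraj
  split_ifs
  · exact measurable_pi_apply _
  · exact measurable_const

instance instProbStdGauss (K : ℕ) : IsProbabilityMeasure (stdGauss K) := by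
  unfold stdGauss; infer_instance

/-- under the pre-change measure `P_∞` (the infinite product of standard
Gaussians `N(0, I)` over the coordinates indexed from `1`, characterized by its
finite-dimensional marginals), the likelihood ratio
`L_t(y) = Π_{i=1}^{t} N(y_i; A μ_{i−1}(y), A Σ_{i−1} Aᵀ + R + I) / N(y_i; 0, I)`
built from the forward-variable recursions for `Σ_t` and `μ_t(y)` satisfies
`∫ L_t dP_∞ = 1` for every `t`. -/
theorem likelihood_ratio_integral_one {K : ℕ} (hK : 1 ≤ K)
    (A R S0 : Matrix (Fin K) (Fin K) ℝ) (μ₀ : Fin K → ℝ)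
    (hR : R.PosDef) (hS0 : S0.PosDef)
    (P : Measure (ℕ → Fin K → ℝ)) [IsProbabilityMeasure P]
    (hP : ∀ n : ℕ,
      P.map (fun y => fun i : Fin n => y (i.val + 1)) =
        Measure.pi fun _ : Fin n => stdGauss K)
    (S : ℕ → Matrix (Fin K) (Fin K) ℝ)
    (hS0' : S 0 = S0)
    (hSrec : ∀ t : ℕ, S (t + 1) = (A * S t * Aᵀ + R) * (A * S t * Aᵀ + R + 1)⁻¹)
    (μ : (ℕ → Fin K → ℝ) → ℕ → Fin K → ℝ)
    (hμ0 : ∀ y, μ y 0 = μ₀)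
    (hμrec : ∀ y, ∀ t : ℕ,
      μ y (t + 1) =
        (A * S t * Aᵀ + R + 1)⁻¹ *ᵥ (A *ᵥ μ y t) + S (t + 1) *ᵥ y (t + 1))
    (L : (ℕ → Fin K → ℝ) → ℕ → ℝ)
    (hL : ∀ y, ∀ t : ℕ,
      L y t = ∏ i ∈ Finset.Icc 1 t,
        gaussDensity (A *ᵥ μ y (i - 1)) (A * S (i - 1) * Aᵀ + R + 1) (y i) /
          gaussDensity 0 1 (y i)) :
    ∀ t : ℕ, ∫ y, L y t ∂P = 1 := by
  classical
  have hSpos : ∀ t, (S t).PosDef := by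
    intro t
    induction t with
    | zero => rw [hS0']; exact hS0
    | succ t ih => rw [hSrec]; exact posDef_next (posDef_step hR ih)
  have hCpos : ∀ t, (A * S t * Aᵀ + R + 1).PosDef := fun t =>
    (posDef_step hR (hSpos t)).add PosDef.one
  have hμcongr : ∀ y y' (t : ℕ), (∀ i, 1 ≤ i → i ≤ t → y i = y' i) → μ y t = μ y' t := by
    intro y y' t
    induction t with
    | zero => intro _; rw [hμ0, hμ0]
    | succ t ih =>
      intro h
      rw [hμrec, hμrec, ih fun i h1 h2 => h i h1 (by omega), h (t + 1) (by omega) le_rfl]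
  have hLsucc : ∀ y t, L y (t + 1) = L y t *
      (gaussDensity (A *ᵥ μ y t) (A * S t * Aᵀ + R + 1) (y (t + 1)) /
        gaussDensity 0 1 (y (t + 1))) := by
    intro y t
    rw [hL, hL, Finset.prod_Icc_succ_top (by omega), Nat.add_sub_cancel]
  have hL0 : ∀ y, L y 0 = 1 := fun y => by rw [hL]; simp
  have hLcongr : ∀ y y' (t : ℕ), (∀ i, 1 ≤ i → i ≤ t → y i = y' i) → L y t = L y' t := by
    intro y y' t
    induction t with
    | zero => intro _; rw [hL0, hL0]
    | succ t ih =>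
      intro h
      have h' : ∀ i, 1 ≤ i → i ≤ t → y i = y' i := fun i h1 h2 => h i h1 (by omega)
      rw [hLsucc, hLsucc, ih h', hμcongr y y' t h', h (t + 1) (by omega) le_rfl]
  have hLnn : ∀ y t, 0 ≤ L y t := by
    intro y t
    rw [hL]
    exact Finset.prod_nonneg fun i _ => div_nonneg (gaussDensity_pos _ (hCpos _) _).le
      (gaussDensity_pos _ PosDef.one _).le
  have hmv : ∀ M : Matrix (Fin K) (Fin K) ℝ, Measurable fun v : Fin K → ℝ => M *ᵥ v :=
    fun M => (continuous_const.matrix_mulVec continuous_id).measurable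
  have hμm : ∀ t, Measurable fun y => μ y t := by
    intro t
    induction t with
    | zero => simp only [hμ0]; exact measurable_const
    | succ t ih =>
      simp only [hμrec]
      exact ((hmv _).comp ((hmv _).comp ih)).add ((hmv _).comp (measurable_pi_apply _))
  have hLm : ∀ t, Measurable fun y => L y t := by
    intro t
    induction t with
    | zero => simp only [hL0]; exact measurable_const
    | succ t ih =>
      simp only [hLsucc]
      refine ih.mul (Measurable.div ?_ ?_)
      · exact measurable_gaussDensity_comp _ ((hmv A).comp (hμm t)) (measurable_pi_apply (t + 1))
      · exact measurable_gaussDensity_comp _ measurable_const (measurable_pi_apply (t + 1))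
  have key : ∀ t, ∫⁻ z, ENNReal.ofReal (L (extTraj z) t)
      ∂(Measure.pi fun _ : Fin t => stdGauss K) = 1 := by
    intro t
    induction t with
    | zero => simp [hL0]
    | succ t ih =>
      have hmp := (measurePreserving_piFinSuccAbove (fun _ : Fin (t + 1) => stdGauss K)
        (Fin.last t)).symm
      rw [← hmp.lintegral_comp_emb (MeasurableEquiv.measurableEmbedding _),
        lintegral_prod_symm]
      · rw [← ih]
        refine lintegral_congr fun z => ?_
        have h1 : ∀ x : Fin K → ℝ, ENNReal.ofReal (L (extTraj
            ((MeasurableEquiv.piFinSuccAbove (fun _ : Fin (t + 1) => Fin K → ℝ)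
              (Fin.last t)).symm (x, z))) (t + 1)) =
            ENNReal.ofReal (L (extTraj z) t) * ENNReal.ofReal
            (gaussDensity (A *ᵥ μ (extTraj z) t) (A * S t * Aᵀ + R + 1) x /
              gaussDensity 0 1 x) := by
          intro x
          have ha : ∀ i, 1 ≤ i → i ≤ t → extTraj
            ((MeasurableEquiv.piFinSuccAbove (fun _ : Fin (t + 1) => Fin K → ℝ)
              (Fin.last t)).symm (x, z)) i = extTraj z i := by
            intro i h1 h2
            have e1 : i - 1 < t := by omega
            have e2 : i - 1 < t + 1 := by omega
            simp only [extTraj, e1, e2, dif_pos]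
            have : (⟨i - 1, e2⟩ : Fin (t + 1)) = Fin.castSucc ⟨i - 1, e1⟩ := rfl
            rw [this]
            simp [MeasurableEquiv.piFinSuccAbove_symm_apply, Fin.snoc, e1]
          have hb : extTraj
            ((MeasurableEquiv.piFinSuccAbove (fun _ : Fin (t + 1) => Fin K → ℝ)
              (Fin.last t)).symm (x, z)) (t + 1) = x := by
            have e2 : t + 1 - 1 < t + 1 := by omega
            simp only [extTraj, e2, dif_pos]
            have : (⟨t + 1 - 1, e2⟩ : Fin (t + 1)) = Fin.last t := rfl
            rw [this]
            simp [MeasurableEquiv.piFinSuccAbove_symm_apply]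
          rw [hLsucc, hb, hLcongr _ _ t ha, hμcongr _ _ t ha, ENNReal.ofReal_mul (hLnn _ _)]
        simp only [h1]
        rw [lintegral_const_mul' _ _ ENNReal.ofReal_ne_top]
        rw [lintegral_ratio _ (hCpos t), mul_one]
      · exact (((hLm (t + 1)).comp (measurable_extTraj K (t + 1))).comp
          (MeasurableEquiv.measurable _)).ennreal_ofReal.aemeasurable
  intro t
  have hr : Measurable fun (y : ℕ → Fin K → ℝ) => fun i : Fin t => y (i.val + 1) :=
    measurable_pi_lambda _ fun i => measurable_pi_apply _
  have h1 : ∫⁻ y, ENNReal.ofReal (L y t) ∂P = 1 := by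
    have hm : Measurable fun z : Fin t → Fin K → ℝ => ENNReal.ofReal (L (extTraj z) t) :=
      ((hLm t).comp (measurable_extTraj K t)).ennreal_ofReal
    rw [← key t, ← hP t, lintegral_map hm hr]
    refine lintegral_congr fun y => ?_
    congr 1
    refine hLcongr _ _ t fun i h1 h2 => ?_
    have e1 : i - 1 < t := by omega
    simp only [extTraj, e1, dif_pos]
    congr 1
    omega
  rw [integral_eq_lintegral_of_nonneg_ae (Filter.Eventually.of_forall fun y => hLnn y t)
    (hLm t).aestronglyMeasurable, h1, ENNReal.toReal_one]
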